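/- arXiv:1311.5667 — 2 statements merged into one kernel-verified Lean document; each statement's English description precedes it below -/
import Mathlib

section
/- Law of order estimation, Case I with m = 0 and ε = δ = 1: if the characteristic exponent is m = 0 and ε = δ = 1, then the averaged T¹-type quantity satisfies ⟨A⟩(Δr) = O(1/τ) as Δr → 0⁺; explicitly, there exist constants C > 0 and Δ₀ > 0 such that τ·|⟨A⟩(Δr)| ≤ C for all Δr ∈ (0, Δ₀). -/
open Filter Finset

noncomputable section

/-- Transition probability η on trits: η(0) = (β/2)(1 − Pe/2), η(1) = 1 − β,
η(2) = (β/2)(1 + Pe/2). -/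
def eta (β Pe : ℝ) (ω : Fin 3) : ℝ :=
  if (ω : ℕ) = 0 then β / 2 * (1 - Pe / 2)
  else if (ω : ℕ) = 1 then 1 - β
  else β / 2 * (1 + Pe / 2)

/-- ν(ω) = η(2 − ω). -/
def nu (β Pe : ℝ) (ω : Fin 3) : ℝ :=
  if (ω : ℕ) = 0 then β / 2 * (1 + Pe / 2)
  else if (ω : ℕ) = 1 then 1 - β
  else β / 2 * (1 - Pe / 2)

/-- Bulk local density ρ̂ⱼ(u′) = (∏ η(u_d)/ν(u_d)) · ρ₀(r + (j + Σ (1 − u_d))·Δr). -/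
def rhoHat (β Pe r Δr : ℝ) (ρ₀ : ℝ → ℝ) {K : ℕ} (j : ℤ) (u : Fin K → Fin 3) : ℝ :=
  (∏ d, eta β Pe (u d) / nu β Pe (u d)) *
    ρ₀ (r + ((j : ℝ) + ∑ d, (1 - ((u d : ℕ) : ℝ))) * Δr)

/-- F_j(ω, u) with u = u₀u′ :
F_j(ω,u) = f((η(ω)/ν(ω))·ρ̂_j(u′), (η(u₀)/ν(u₀))·ρ̂_{j+1−u₀}(u′)). -/
def Floc (β Pe r Δr : ℝ) (ρ₀ : ℝ → ℝ) (f : ℝ → ℝ → ℝ) {K : ℕ}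
    (j : ℤ) (ω u₀ : Fin 3) (u' : Fin K → Fin 3) : ℝ :=
  f (eta β Pe ω / nu β Pe ω * rhoHat β Pe r Δr ρ₀ j u')
    (eta β Pe u₀ / nu β Pe u₀ * rhoHat β Pe r Δr ρ₀ (j + 1 - ((u₀ : ℕ) : ℤ)) u')

/-- K(Δr): the sum over the trit ω and the k-digit trit string u = u₀u′. -/
def Ksum (D v β r : ℝ) (k : ℕ) (ρ₀ : ℝ → ℝ) (f : ℝ → ℝ → ℝ)
    (ε δ : ℝ) (m : ℕ) (Δr : ℝ) : ℝ :=
  Δr * ∑ ω : Fin 3, ∑ u₀ : Fin 3, ∑ u' : Fin (k - 1) → Fin 3,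
    (eta β (v * Δr / D) ω + δ * nu β (v * Δr / D) ω) *
      (nu β (v * Δr / D) u₀ * ∏ d, nu β (v * Δr / D) (u' d)) *
      (Floc β (v * Δr / D) r Δr ρ₀ f 0 ω u₀ u' +
        ε * (-1 : ℝ) ^ m * Floc β (v * Δr / D) r Δr ρ₀ f (1 - ((ω : ℕ) : ℤ)) ω u₀ u')

/-- The spatio-temporally averaged T¹-type quantity ⟨A⟩(Δr) = K/(τ·Δr),
with τ = β·Δr²/(2D). -/
def avgA (D v β r : ℝ) (k : ℕ) (ρ₀ : ℝ → ℝ) (f : ℝ → ℝ → ℝ)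
    (ε δ : ℝ) (m : ℕ) (Δr : ℝ) : ℝ :=
  Ksum D v β r k ρ₀ f ε δ m Δr / (β * Δr ^ 2 / (2 * D) * Δr)

/-- f̃(X,Y) = f(Y + X, Y − X). -/
def ftilde (f : ℝ → ℝ → ℝ) (X Y : ℝ) : ℝ := f (Y + X) (Y - X)

lemma continuousAt_eta (β a : ℝ) (ω : Fin 3) :
    ContinuousAt (fun x => eta β (a * x) ω) 0 := by
  unfold eta
  split_ifs <;> fun_prop

lemma continuousAt_nu (β a : ℝ) (ω : Fin 3) :
    ContinuousAt (fun x => nu β (a * x) ω) 0 := by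
  unfold nu
  split_ifs <;> fun_prop

lemma nu_zero_ne_zero {β : ℝ} (hβ0 : 0 < β) (hβ1 : β < 1) (ω : Fin 3) : nu β 0 ω ≠ 0 := by
  unfold nu
  split_ifs <;> simp <;> linarith

lemma continuousAt_eta_div_nu {β : ℝ} (hβ0 : 0 < β) (hβ1 : β < 1) (a : ℝ) (ω : Fin 3) :
    ContinuousAt (fun x => eta β (a * x) ω / nu β (a * x) ω) 0 :=
  (continuousAt_eta β a ω).div (continuousAt_nu β a ω)
    (by simpa using nu_zero_ne_zero hβ0 hβ1 ω)

lemma continuousAt_rhoHat {β : ℝ} (hβ0 : 0 < β) (hβ1 : β < 1) (a r : ℝ) {ρ₀ : ℝ → ℝ}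
    (hρ : Continuous ρ₀) {K : ℕ} (j : ℤ) (u : Fin K → Fin 3) :
    ContinuousAt (fun x => rhoHat β (a * x) r x ρ₀ j u) 0 := by
  unfold rhoHat
  refine ContinuousAt.mul ?_ (by fun_prop)
  exact tendsto_finsetProd _ fun d _ => continuousAt_eta_div_nu hβ0 hβ1 a (u d)

lemma continuousAt_Floc {β : ℝ} (hβ0 : 0 < β) (hβ1 : β < 1) (a r : ℝ) {ρ₀ : ℝ → ℝ}
    (hρ : Continuous ρ₀) {f : ℝ → ℝ → ℝ} (hf : Continuous (Function.uncurry f)) {K : ℕ}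
    (j : ℤ) (ω u₀ : Fin 3) (u' : Fin K → Fin 3) :
    ContinuousAt (fun x => Floc β (a * x) r x ρ₀ f j ω u₀ u') 0 :=
  hf.continuousAt.comp
    (((continuousAt_eta_div_nu hβ0 hβ1 a ω).mul
        (continuousAt_rhoHat hβ0 hβ1 a r hρ j u')).prodMk
      ((continuousAt_eta_div_nu hβ0 hβ1 a u₀).mul
        (continuousAt_rhoHat hβ0 hβ1 a r hρ (j + 1 - ((u₀ : ℕ) : ℤ)) u')))

/-- `Ksum` is `Δr` times a function of `Δr` that is continuous at `0`. -/
lemma exists_Ksum_eq_mul {β : ℝ} (hβ0 : 0 < β) (hβ1 : β < 1) (D v r : ℝ) (k : ℕ)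
    {ρ₀ : ℝ → ℝ} (hρ : Continuous ρ₀) {f : ℝ → ℝ → ℝ} (hf : Continuous (Function.uncurry f))
    (ε δ : ℝ) (m : ℕ) :
    ∃ S : ℝ → ℝ, ContinuousAt S 0 ∧ ∀ x, Ksum D v β r k ρ₀ f ε δ m x = x * S x := by
  refine ⟨_, ?_, fun x => rfl⟩
  simp only [mul_div_right_comm v _ D]
  refine tendsto_finsetSum _ fun ω _ => tendsto_finsetSum _ fun u₀ _ =>
    tendsto_finsetSum _ fun u' _ => ?_
  have hη := continuousAt_eta β (v / D)
  have hν := continuousAt_nu β (v / D)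
  have hF := fun j => continuousAt_Floc hβ0 hβ1 (v / D) r hρ hf j ω u₀ u'
  exact (((hη ω).add ((hν ω).const_mul δ)).mul
    ((hν u₀).mul (tendsto_finsetProd _ fun d _ => hν (u' d)))).mul
    ((hF 0).add ((hF _).const_mul _))

/-- LOE, Case I with m = 0 and ε = δ = 1: ⟨A⟩(Δr) = O(1/τ) as Δr → 0⁺;
explicitly there are C > 0, Δ₀ > 0 with τ·|⟨A⟩(Δr)| ≤ C for 0 < Δr < Δ₀. -/
theorem LOE_caseI_m_zero
    (D v β r : ℝ) (k : ℕ) (ρ₀ : ℝ → ℝ) (f : ℝ → ℝ → ℝ)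
    (ε δ : ℝ) (m : ℕ) (Chat : ℝ → ℝ)
    (hD : 0 < D) (hβ0 : 0 < β) (hβ1 : β < 1) (hk : 1 ≤ k)
    (hρ : ContDiff ℝ (⊤ : ℕ∞) ρ₀) (hρpos : ∀ x, 0 < ρ₀ x)
    (hf : ContDiff ℝ (⊤ : ℕ∞) (Function.uncurry f))
    (hε : ε = 1 ∨ ε = -1) (hδ : δ = 1 ∨ δ = -1)
    (hsym : ∀ x y, f y x = (-1 : ℝ) ^ m * f x y)
    (hlow : ∀ Y : ℝ, ∀ j < m, iteratedDeriv j (fun X => ftilde f X Y) 0 = 0)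
    (hchar : ∀ Y : ℝ, iteratedDeriv m (fun X => ftilde f X Y) 0 = (m.factorial : ℝ) * Chat Y)
    (hCbdd : ∃ M : ℝ, ∀ y, |Chat y| ≤ M) (hCne : ∀ y, Chat y ≠ 0)
    (hm0 : m = 0) (hε1 : ε = 1) (hδ1 : δ = 1) :
    ∃ C > 0, ∃ Δ₀ > 0, ∀ Δr : ℝ, 0 < Δr → Δr < Δ₀ →
      β * Δr ^ 2 / (2 * D) * |avgA D v β r k ρ₀ f ε δ m Δr| ≤ C := by
  obtain ⟨S, hS, hK⟩ := exists_Ksum_eq_mul hβ0 hβ1 D v r k hρ.continuous hf.continuous ε δ m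
  obtain ⟨Δ₀, hΔ₀, hbound⟩ := Metric.eventually_nhds_iff.mp
    (hS.abs.eventually_lt continuousAt_const (lt_add_one |S 0|))
  refine ⟨|S 0| + 1, by positivity, Δ₀, hΔ₀, fun Δr hpos hlt => ?_⟩
  have hτ : 0 < β * Δr ^ 2 / (2 * D) := by positivity
  have havg : avgA D v β r k ρ₀ f ε δ m Δr = S Δr / (β * Δr ^ 2 / (2 * D)) := by
    rw [avgA, hK, mul_comm Δr, mul_div_mul_right _ _ hpos.ne']
  rw [havg, abs_div, abs_of_pos hτ, mul_div_cancel₀ _ hτ.ne']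
  exact (hbound (by simpa [abs_of_pos hpos] using hlt)).le
end
end

section
/- Law of order estimation, Case I with m even positive and ε = δ = 1: if the characteristic exponent m is a positive even integer and ε = δ = 1, then the averaged T¹-type quantity satisfies ⟨A⟩(Δr) = O(Δr^{m−2}) as Δr → 0⁺, i.e. Δr^{2−m}·⟨A⟩(Δr) stays bounded for small Δr > 0. -/
open Filter Finset

noncomputable section

/-- A smooth function whose derivatives of order `< n` vanish at the origin is bounded by
`|x| ^ n` times a bound of its `n`-th derivative. -/
lemma abs_le_mul_pow_of_iteratedDeriv_eq_zero {C R : ℝ} (n : ℕ) :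
    ∀ g : ℝ → ℝ, ContDiff ℝ (⊤ : ℕ∞) g → (∀ j < n, iteratedDeriv j g 0 = 0) →
      (∀ x, |x| ≤ R → |iteratedDeriv n g x| ≤ C) → ∀ x, |x| ≤ R → |g x| ≤ C * |x| ^ n := by
  induction n with
  | zero => intro g _ _ hb x hx; simpa using hb x hx
  | succ n ih =>
    intro g hg hlow hb x hx
    have hg' : ContDiff ℝ (⊤ : ℕ∞) (deriv g) := (contDiff_infty_iff_deriv.1 hg).2
    have hderiv := ih (deriv g) hg'
      (fun j hj => by rw [← iteratedDeriv_succ']; exact hlow (j + 1) (by omega))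
      (fun y hy => by rw [← iteratedDeriv_succ']; exact hb y hy)
    have hC : 0 ≤ C := (abs_nonneg _).trans (hb x hx)
    have hzero : g 0 = 0 := by simpa using hlow 0 (by omega)
    have hmv := (convex_uIcc (0 : ℝ) x).norm_image_sub_le_of_norm_deriv_le (f := g)
      (C := C * |x| ^ n)
      (fun y _ => (hg.differentiable (by simp)).differentiableAt)
      (fun y hy => by
        have hyx : |y| ≤ |x| := by
          simpa using Set.abs_sub_left_of_mem_uIcc hy
        exact (hderiv y (hyx.trans hx)).trans (by gcongr))
      Set.left_mem_uIcc Set.right_mem_uIcc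
    simpa [hzero, pow_succ, mul_assoc] using hmv

/-- Iterated partial derivatives in the first variable of a smooth function of two variables are
jointly smooth. -/
lemma contDiff_iteratedDeriv_fst {g : ℝ × ℝ → ℝ} (hg : ContDiff ℝ (⊤ : ℕ∞) g) (n : ℕ) :
    ContDiff ℝ (⊤ : ℕ∞) fun p : ℝ × ℝ => iteratedDeriv n (fun X => g (X, p.2)) p.1 := by
  induction n with
  | zero => simpa using hg
  | succ n ih =>
    have heq : (fun p : ℝ × ℝ => iteratedDeriv (n + 1) (fun X => g (X, p.2)) p.1) =
        fun p => fderiv ℝ (fun p : ℝ × ℝ => iteratedDeriv n (fun X => g (X, p.2)) p.1) p (1, 0) := by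
      ext p
      rw [iteratedDeriv_succ]
      have hline : HasDerivAt (fun X : ℝ => (X, p.2)) ((1 : ℝ), (0 : ℝ)) p.1 :=
        (hasDerivAt_id p.1).prodMk (hasDerivAt_const p.1 p.2)
      exact (((ih.differentiable (by simp)) p).hasFDerivAt.comp_hasDerivAt p.1 hline).deriv
    rw [heq]
    exact (ih.fderiv_right (by simp)).clm_apply contDiff_const

open Asymptotics Topology in
/-- If `X ↦ f (Y + X) (Y - X)` vanishes to order `m` at the origin for every `Y`, then
`f x y = O((x - y) ^ m)` near each diagonal point. -/
lemma isBigO_sub_pow_of_ftilde {f : ℝ → ℝ → ℝ} {m : ℕ}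
    (hf : ContDiff ℝ (⊤ : ℕ∞) (Function.uncurry f))
    (hlow : ∀ Y : ℝ, ∀ j < m, iteratedDeriv j (fun X => ftilde f X Y) 0 = 0) (c : ℝ) :
    (fun p : ℝ × ℝ => f p.1 p.2) =O[𝓝 (c, c)] fun p => (p.1 - p.2) ^ m := by
  have hg : ContDiff ℝ (⊤ : ℕ∞) fun p : ℝ × ℝ => ftilde f p.1 p.2 :=
    hf.comp ((contDiff_snd.add contDiff_fst).prodMk (contDiff_snd.sub contDiff_fst))
  have hcont := (contDiff_iteratedDeriv_fst hg m).continuous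
  obtain ⟨C, hC⟩ := ((isCompact_Icc (a := (-1 : ℝ)) (b := 1)).prod
    (isCompact_Icc (a := c - 1) (b := c + 1))).exists_bound_of_continuousOn hcont.continuousOn
  have hX : ∀ᶠ p : ℝ × ℝ in 𝓝 (c, c), |(p.1 - p.2) / 2| < 1 :=
    ContinuousAt.eventually_lt (by fun_prop) continuousAt_const (by simp)
  have hY : ∀ᶠ p : ℝ × ℝ in 𝓝 (c, c), |(p.1 + p.2) / 2 - c| < 1 :=
    ContinuousAt.eventually_lt (by fun_prop) continuousAt_const (by simp)
  refine IsBigO.of_bound (C * (1 / 2) ^ m) ?_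
  filter_upwards [hX, hY] with p hpX hpY
  have hline : ContDiff ℝ (⊤ : ℕ∞) fun X => ftilde f X ((p.1 + p.2) / 2) :=
    hg.comp (contDiff_id.prodMk contDiff_const)
  have key := abs_le_mul_pow_of_iteratedDeriv_eq_zero (C := C) (R := 1) m _ hline (hlow _)
    (fun X hX => hC (X, (p.1 + p.2) / 2)
      ⟨abs_le.1 hX, by constructor <;> linarith [abs_lt.1 hpY]⟩) _ hpX.le
  have hval : ftilde f ((p.1 - p.2) / 2) ((p.1 + p.2) / 2) = f p.1 p.2 := by
    unfold ftilde; congr 1 <;> ring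
  rw [hval, abs_div, div_pow, abs_two] at key
  rw [Real.norm_eq_abs, norm_pow, Real.norm_eq_abs]
  calc _ ≤ _ := key
    _ = _ := by rw [one_div, inv_pow]; ring

lemma differentiableAt_eta (D v β : ℝ) (ω : Fin 3) :
    DifferentiableAt ℝ (fun h : ℝ => eta β (v * h / D) ω) 0 := by
  unfold eta; split_ifs <;> fun_prop

lemma differentiableAt_nu (D v β : ℝ) (ω : Fin 3) :
    DifferentiableAt ℝ (fun h : ℝ => nu β (v * h / D) ω) 0 := by
  unfold nu; split_ifs <;> fun_prop

lemma eta_zero_eq_nu_zero (β : ℝ) (ω : Fin 3) : eta β 0 ω = nu β 0 ω := by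
  simp [eta, nu]

section Bulk

variable {D v β r : ℝ} {ρ₀ : ℝ → ℝ}

lemma differentiableAt_eta_div_nu (hβ0 : 0 < β) (hβ1 : β < 1) (ω : Fin 3) :
    DifferentiableAt ℝ (fun h : ℝ => eta β (v * h / D) ω / nu β (v * h / D) ω) 0 :=
  (differentiableAt_eta D v β ω).div (differentiableAt_nu D v β ω)
    (by simpa using nu_zero_ne_zero hβ0 hβ1 ω)

lemma eta_zero_div_nu_zero (hβ0 : 0 < β) (hβ1 : β < 1) (ω : Fin 3) :
    eta β 0 ω / nu β 0 ω = 1 := by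
  rw [eta_zero_eq_nu_zero, div_self (nu_zero_ne_zero hβ0 hβ1 ω)]

lemma differentiableAt_rhoHat (hβ0 : 0 < β) (hβ1 : β < 1) (hρ : Differentiable ℝ ρ₀) {K : ℕ}
    (j : ℤ) (u : Fin K → Fin 3) :
    DifferentiableAt ℝ (fun h : ℝ => rhoHat β (v * h / D) r h ρ₀ j u) 0 := by
  unfold rhoHat
  refine DifferentiableAt.mul ?_ ?_
  · exact DifferentiableAt.fun_finsetProd fun d _ => differentiableAt_eta_div_nu hβ0 hβ1 (u d)
  · exact (hρ _).comp (0 : ℝ) (by fun_prop)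

lemma rhoHat_zero (hβ0 : 0 < β) (hβ1 : β < 1) {K : ℕ} (j : ℤ) (u : Fin K → Fin 3) :
    rhoHat β 0 r 0 ρ₀ j u = ρ₀ r := by
  simp [rhoHat, eta_zero_div_nu_zero hβ0 hβ1]

open Asymptotics Topology in
/-- Each local contribution `F_j(ω, u)` is of order `Δr ^ m`. -/
lemma isBigO_Floc {f : ℝ → ℝ → ℝ} {m : ℕ} (hβ0 : 0 < β) (hβ1 : β < 1)
    (hρ : Differentiable ℝ ρ₀) (hf : ContDiff ℝ (⊤ : ℕ∞) (Function.uncurry f))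
    (hlow : ∀ Y : ℝ, ∀ j < m, iteratedDeriv j (fun X => ftilde f X Y) 0 = 0)
    {K : ℕ} (j : ℤ) (ω u₀ : Fin 3) (u' : Fin K → Fin 3) :
    (fun h : ℝ => Floc β (v * h / D) r h ρ₀ f j ω u₀ u') =O[𝓝 0] fun h => h ^ m := by
  have hdiff (i : ℤ) (w : Fin 3) : DifferentiableAt ℝ (fun h : ℝ =>
      eta β (v * h / D) w / nu β (v * h / D) w * rhoHat β (v * h / D) r h ρ₀ i u') 0 :=
    (differentiableAt_eta_div_nu hβ0 hβ1 w).mul (differentiableAt_rhoHat hβ0 hβ1 hρ i u')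
  have hval (i : ℤ) (w : Fin 3) :
      eta β (v * 0 / D) w / nu β (v * 0 / D) w * rhoHat β (v * 0 / D) r 0 ρ₀ i u' = ρ₀ r := by
    simp [eta_zero_div_nu_zero hβ0 hβ1, rhoHat_zero hβ0 hβ1]
  have htend (i : ℤ) (w : Fin 3) := (hdiff i w).continuousAt.tendsto
  simp only [hval] at htend
  have hsub := ((hdiff j ω).sub (hdiff (j + 1 - ((u₀ : ℕ) : ℤ)) u₀)).isBigO_sub
  simp only [Pi.sub_apply, hval, sub_self, sub_zero] at hsub
  exact ((isBigO_sub_pow_of_ftilde hf hlow (ρ₀ r)).comp_tendsto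
    ((htend j ω).prodMk_nhds (htend (j + 1 - ((u₀ : ℕ) : ℤ)) u₀))).trans (hsub.pow m)

open Asymptotics Topology in
lemma isBigO_Ksum {f : ℝ → ℝ → ℝ} {m : ℕ} (k : ℕ) (ε δ : ℝ) (hβ0 : 0 < β) (hβ1 : β < 1)
    (hρ : Differentiable ℝ ρ₀) (hf : ContDiff ℝ (⊤ : ℕ∞) (Function.uncurry f))
    (hlow : ∀ Y : ℝ, ∀ j < m, iteratedDeriv j (fun X => ftilde f X Y) 0 = 0) :
    (fun h : ℝ => Ksum D v β r k ρ₀ f ε δ m h) =O[𝓝 0] fun h => h * h ^ m := by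
  unfold Ksum
  refine (isBigO_refl _ _).mul ?_
  refine IsBigO.fun_sum fun ω _ => ?_
  refine IsBigO.fun_sum fun u₀ _ => ?_
  refine IsBigO.fun_sum fun u' _ => ?_
  have hcoef : DifferentiableAt ℝ (fun h : ℝ =>
      (eta β (v * h / D) ω + δ * nu β (v * h / D) ω) *
        (nu β (v * h / D) u₀ * ∏ d, nu β (v * h / D) (u' d))) 0 :=
    ((differentiableAt_eta D v β ω).add ((differentiableAt_nu D v β ω).const_mul δ)).mul
      ((differentiableAt_nu D v β u₀).mul
        (DifferentiableAt.fun_finsetProd fun d _ => differentiableAt_nu D v β (u' d)))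
  have hF := (isBigO_Floc (D := D) (v := v) (r := r) hβ0 hβ1 hρ hf hlow 0 ω u₀ u').add
    ((isBigO_Floc (D := D) (v := v) (r := r) hβ0 hβ1 hρ hf hlow
      (1 - ((ω : ℕ) : ℤ)) ω u₀ u').const_mul_left (ε * (-1 : ℝ) ^ m))
  simpa using (hcoef.continuousAt.tendsto.isBigO_one ℝ).mul hF

end Bulk

/-- LOE, Case I with m even positive and ε = δ = 1: ⟨A⟩(Δr) = O(Δr^(m−2)). -/
theorem LOE_caseI_m_even_pos
    (D v β r : ℝ) (k : ℕ) (ρ₀ : ℝ → ℝ) (f : ℝ → ℝ → ℝ)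
    (ε δ : ℝ) (m : ℕ) (Chat : ℝ → ℝ)
    (hD : 0 < D) (hβ0 : 0 < β) (hβ1 : β < 1) (hk : 1 ≤ k)
    (hρ : ContDiff ℝ (⊤ : ℕ∞) ρ₀) (hρpos : ∀ x, 0 < ρ₀ x)
    (hf : ContDiff ℝ (⊤ : ℕ∞) (Function.uncurry f))
    (hε : ε = 1 ∨ ε = -1) (hδ : δ = 1 ∨ δ = -1)
    (hsym : ∀ x y, f y x = (-1 : ℝ) ^ m * f x y)
    (hlow : ∀ Y : ℝ, ∀ j < m, iteratedDeriv j (fun X => ftilde f X Y) 0 = 0)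
    (hchar : ∀ Y : ℝ, iteratedDeriv m (fun X => ftilde f X Y) 0 = (m.factorial : ℝ) * Chat Y)
    (hCbdd : ∃ M : ℝ, ∀ y, |Chat y| ≤ M) (hCne : ∀ y, Chat y ≠ 0)
    (hme : Even m) (hmpos : 0 < m) (hε1 : ε = 1) (hδ1 : δ = 1) :
    ∃ C > 0, ∃ Δ₀ > 0, ∀ Δr : ℝ, 0 < Δr → Δr < Δ₀ →
      |avgA D v β r k ρ₀ f ε δ m Δr| ≤ C * Δr ^ ((m : ℤ) - 2) := by
  obtain ⟨C, hC, hbound⟩ := (isBigO_Ksum (D := D) (v := v) (r := r) k ε δ hβ0 hβ1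
    (hρ.differentiable (by simp)) hf hlow).exists_pos
  obtain ⟨Δ₀, hΔ₀, hball⟩ := Metric.eventually_nhds_iff.1 hbound.bound
  refine ⟨C * (2 * D / β), by positivity, Δ₀, hΔ₀, fun h hh hlt => ?_⟩
  have hK := hball (y := h) (by simpa [abs_of_pos hh] using hlt)
  rw [Real.norm_eq_abs, Real.norm_of_nonneg (by positivity)] at hK
  have hden : 0 < β * h ^ 2 / (2 * D) * h := by positivity
  rw [avgA, abs_div, abs_of_pos hden, div_le_iff₀ hden, zpow_sub₀ hh.ne', zpow_natCast]
  refine hK.trans (le_of_eq ?_)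
  have : h ^ (2 : ℤ) = h ^ 2 := by norm_cast
  rw [this]
  field_simp
end
end
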